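/- Let μ be a doubling Radon measure on ℝⁿ (a Borel measure, finite on compact sets, for which there is a constant C_D with 0 < μ(2B) ≤ C_D μ(B) for every ball B, where 2B is the concentric ball of double radius), let 1 ≤ p < ∞ and γ < 0, and let f ∈ L¹_loc(ℝⁿ,μ). For Q ∈ 𝒟 set a(f)_Q = ℓ(Q)^{γ/p} (1/μ(Q)) ∫_Q f dμ when μ(Q) > 0 and a(f)_Q = 0 otherwise. Then there is a constant C = C(n,p,γ,C_D) such that ∫_{ℝⁿ} |f|ᵖ dμ ≤ C · limsup_{λ→∞} λᵖ ∑_{Q∈𝒟 : |a(f)_Q| > λ} ℓ(Q)^{−γ} μ(Q). -/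

import Mathlib

open MeasureTheory Set Filter
open scoped ENNReal Classical Topology

noncomputable section

/-- The half-open dyadic cube in `ℝⁿ` of generation `k` (sidelength `2 ^ k`) and
corner index `j`. -/
def dyadicCube (n : ℕ) (k : ℤ) (j : Fin n → ℤ) : Set (Fin n → ℝ) :=
  Set.univ.pi fun i => Set.Ico ((j i : ℝ) * 2 ^ k) (((j i : ℝ) + 1) * 2 ^ k)

/-- The open Euclidean ball of center `x` and radius `t` in `ℝⁿ`. -/
def eBall {n : ℕ} (x : Fin n → ℝ) (t : ℝ) : Set (Fin n → ℝ) :=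
  {y | ∑ i, (y i - x i) ^ 2 < t ^ 2}

/-- The generation `k` corner index of the dyadic cube containing `x`. -/
def dyadicIndex {n : ℕ} (k : ℤ) (x : Fin n → ℝ) : Fin n → ℤ := fun i => ⌊x i / 2 ^ k⌋

lemma mem_dyadicCube_dyadicIndex {n : ℕ} (k : ℤ) (x : Fin n → ℝ) :
    x ∈ dyadicCube n k (dyadicIndex k x) := by
  have h2 : (0 : ℝ) < 2 ^ k := by positivity
  intro i _
  exact ⟨(le_div_iff₀ h2).1 (Int.floor_le _), (div_lt_iff₀ h2).1 (Int.lt_floor_add_one _)⟩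

lemma measurableSet_dyadicCube (n : ℕ) (k : ℤ) (j : Fin n → ℤ) :
    MeasurableSet (dyadicCube n k j) :=
  MeasurableSet.univ_pi fun _ => measurableSet_Ico

/-- The center of a dyadic cube. -/
def dyadicCenter {n : ℕ} (k : ℤ) (j : Fin n → ℤ) : Fin n → ℝ := fun i => ((j i : ℝ) + 1 / 2) * 2 ^ k

lemma dyadicCube_subset_closedBall {n : ℕ} (k : ℤ) (j : Fin n → ℤ) :
    dyadicCube n k j ⊆ Metric.closedBall (dyadicCenter k j) (2 ^ k / 2) := by
  have h2 : (0 : ℝ) < 2 ^ k := by positivity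
  intro y hy
  rw [Metric.mem_closedBall, dist_pi_le_iff (by positivity)]
  intro i
  obtain ⟨h3, h4⟩ := hy i (Set.mem_univ i)
  rw [Real.dist_eq, abs_le]
  simp only [dyadicCenter]
  constructor <;> linarith

lemma closedBall_subset_dyadicCube {n : ℕ} (k : ℤ) (j : Fin n → ℤ) :
    Metric.closedBall (dyadicCenter k j) (2 ^ k / 4) ⊆ dyadicCube n k j := by
  have h2 : (0 : ℝ) < 2 ^ k := by positivity
  intro y hy i _
  rw [Metric.mem_closedBall, dist_pi_le_iff (by positivity)] at hy
  have h := hy i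
  rw [Real.dist_eq, abs_le] at h
  simp only [dyadicCenter] at h
  constructor <;> linarith [h.1, h.2]

lemma eBall_subset_closedBall {n : ℕ} (x : Fin n → ℝ) {r : ℝ} (hr : 0 < r) :
    eBall x r ⊆ Metric.closedBall x r := by
  intro y hy
  rw [Metric.mem_closedBall, dist_pi_le_iff hr.le]
  intro i
  rw [Real.dist_eq]
  refine abs_le_of_sq_le_sq ?_ hr.le
  have h := Finset.single_le_sum (f := fun i => (y i - x i) ^ 2)
    (fun i _ => sq_nonneg _) (Finset.mem_univ i)
  exact h.trans (le_of_lt hy)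

lemma closedBall_subset_eBall {n : ℕ} (x : Fin n → ℝ) {r : ℝ} (hr : 0 < r) :
    Metric.closedBall x (2 * r) ⊆ eBall x (2 ^ (n + 1) * r) := by
  intro y hy
  rw [Metric.mem_closedBall, dist_pi_le_iff (by positivity)] at hy
  have h1 : ∑ i, (y i - x i) ^ 2 ≤ ∑ _i : Fin n, (2 * r) ^ 2 := by
    refine Finset.sum_le_sum fun i _ => sq_le_sq' ?_ ?_
    · have h := hy i
      rw [Real.dist_eq, abs_le] at h
      linarith [h.1]
    · have h := hy i
      rw [Real.dist_eq, abs_le] at h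
      exact h.2
  have h2 : (n : ℝ) < 4 ^ n := by exact_mod_cast Nat.lt_pow_self (by norm_num)
  have h3 : ((2 : ℝ) ^ (n + 1) * r) ^ 2 = 4 ^ n * (2 * r) ^ 2 := by
    have : (4 : ℝ) ^ n = (2 ^ n) ^ 2 := by rw [← pow_mul, mul_comm, pow_mul]; norm_num
    rw [this]; ring
  change ∑ i, (y i - x i) ^ 2 < _
  rw [h3]
  refine h1.trans_lt ?_
  simp only [Finset.sum_const, Finset.card_univ, Fintype.card_fin, nsmul_eq_mul]
  gcongr

/-- The Euclidean doubling condition. -/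
def EDoubling {n : ℕ} (μ : Measure (Fin n → ℝ)) (D : ℝ≥0∞) : Prop :=
  ∀ (x : Fin n → ℝ) (r : ℝ), 0 < r →
    0 < μ (eBall x (2 * r)) ∧ μ (eBall x (2 * r)) ≤ D * μ (eBall x r)

namespace EDoubling

variable {n : ℕ} {μ : Measure (Fin n → ℝ)} {D : ℝ≥0∞}

lemma measure_closedBall_pos (h : EDoubling μ D) (x : Fin n → ℝ) {r : ℝ} (hr : 0 < r) :
    0 < μ (Metric.closedBall x r) := by
  have h1 := (h x (r / 2) (by positivity)).1
  rw [mul_div_cancel₀ r two_ne_zero] at h1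
  exact h1.trans_le (measure_mono (eBall_subset_closedBall x hr))

lemma measure_eBall_two_pow_mul_le (h : EDoubling μ D) (x : Fin n → ℝ) {r : ℝ} (hr : 0 < r)
    (m : ℕ) : μ (eBall x (2 ^ m * r)) ≤ D ^ m * μ (eBall x r) := by
  induction m with
  | zero => simp
  | succ m ih =>
    have h1 := (h x (2 ^ m * r) (by positivity)).2
    rw [← mul_assoc, ← pow_succ'] at h1
    refine h1.trans ?_
    rw [pow_succ', mul_assoc]
    gcongr

lemma measure_closedBall_two_mul_le (h : EDoubling μ D) (x : Fin n → ℝ) {r : ℝ} (hr : 0 < r) :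
    μ (Metric.closedBall x (2 * r)) ≤ D ^ (n + 1) * μ (Metric.closedBall x r) :=
  (measure_mono (closedBall_subset_eBall x hr)).trans <|
    (h.measure_eBall_two_pow_mul_le x hr (n + 1)).trans <|
      mul_le_mul_right (measure_mono (eBall_subset_closedBall x hr)) _

lemma isUnifLocDoublingMeasure (h : EDoubling μ D) (hD : D ≠ ∞) :
    IsUnifLocDoublingMeasure μ := by
  refine ⟨⟨(D ^ (n + 1)).toNNReal, ?_⟩⟩
  filter_upwards [self_mem_nhdsWithin] with r hr x
  rw [ENNReal.coe_toNNReal (ENNReal.pow_ne_top hD)]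
  exact h.measure_closedBall_two_mul_le x hr

lemma measure_closedBall_le_dyadicCube (h : EDoubling μ D) (k : ℤ) (j : Fin n → ℤ) :
    μ (Metric.closedBall (dyadicCenter k j) (2 ^ k / 2)) ≤ D ^ (n + 1) * μ (dyadicCube n k j) := by
  have h1 := h.measure_closedBall_two_mul_le (dyadicCenter k j) (r := 2 ^ k / 4) (by positivity)
  rw [show (2 : ℝ) * (2 ^ k / 4) = 2 ^ k / 2 by ring] at h1
  exact h1.trans (mul_le_mul_right (measure_mono (closedBall_subset_dyadicCube k j)) _)

end EDoubling

/-- Averages over a set are controlled by averages over a larger set of comparable measure. -/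
lemma abs_setAverage_sub_le {α : Type*} [MeasurableSpace α] {μ : Measure α} {s t : Set α}
    (hst : s ⊆ t) (hs : μ s ≠ 0) (ht : μ t ≠ ∞) {D : ℝ≥0∞} (hD : D ≠ ∞)
    (hle : μ t ≤ D * μ s) {f : α → ℝ} (hf : IntegrableOn f t μ) (c : ℝ) :
    |(⨍ x in s, f x ∂μ) - c| ≤ D.toReal * ⨍ x in t, ‖f x - c‖ ∂μ := by
  have hs' : μ s ≠ ∞ := ne_top_of_le_ne_top ht (measure_mono hst)
  have h0 : 0 < μ.real s := ENNReal.toReal_pos hs hs'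
  have h1 : 0 < μ.real t :=
    ENNReal.toReal_pos (fun h => hs (measure_mono_null hst h)) ht
  have hle' : μ.real t ≤ D.toReal * μ.real s := by
    have := ENNReal.toReal_mono (ENNReal.mul_ne_top hD hs') hle
    rwa [ENNReal.toReal_mul] at this
  have hci : IntegrableOn (fun x => ‖f x - c‖) t μ := (hf.sub (integrableOn_const ht)).norm
  have h2 : (⨍ x in s, f x ∂μ) - c = (μ.real s)⁻¹ * ∫ x in s, (f x - c) ∂μ := by
    rw [setAverage_eq, integral_sub (hf.mono_set hst) (integrableOn_const hs'),
      setIntegral_const, smul_eq_mul, smul_eq_mul]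
    field_simp
  have h3 : |∫ x in s, (f x - c) ∂μ| ≤ ∫ x in t, ‖f x - c‖ ∂μ :=
    (norm_integral_le_integral_norm _).trans
      (setIntegral_mono_set hci (ae_of_all _ fun _ => norm_nonneg _) hst.eventuallyLE)
  have h4 : 0 ≤ ∫ x in t, ‖f x - c‖ ∂μ := integral_nonneg fun _ => norm_nonneg _
  rw [h2, abs_mul, abs_of_pos (inv_pos.2 h0), setAverage_eq, smul_eq_mul, ← mul_assoc]
  refine mul_le_mul ?_ h3 (abs_nonneg _) (by positivity)
  rw [← div_eq_mul_inv, inv_eq_one_div, div_le_div_iff₀ h0 h1, one_mul]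
  exact hle'

/-- Lebesgue differentiation along the dyadic cubes for doubling measures. -/
lemma EDoubling.ae_tendsto_dyadic_average {n : ℕ} {μ : Measure (Fin n → ℝ)}
    [IsFiniteMeasureOnCompacts μ] {D : ℝ≥0∞} (h : EDoubling μ D) (hD : D ≠ ∞)
    {f : (Fin n → ℝ) → ℝ} (hf : LocallyIntegrable f μ) :
    ∀ᵐ x ∂μ, Tendsto (fun k : ℤ => ⨍ y in dyadicCube n k (dyadicIndex k x), f y ∂μ)
      atBot (𝓝 (f x)) := by
  have := h.isUnifLocDoublingMeasure hD
  filter_upwards [IsUnifLocDoublingMeasure.ae_tendsto_average_norm_sub μ hf 1] with x hx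
  have hδ : Tendsto (fun k : ℤ => (2 : ℝ) ^ k / 2) atBot (𝓝[>] 0) := by
    refine tendsto_nhdsWithin_iff.2 ⟨?_, Eventually.of_forall fun k => ?_⟩
    · have h2 : Tendsto (fun k : ℤ => (2 : ℝ) ^ k) atBot (𝓝 0) := by
        simpa [Function.comp_def] using ((tendsto_rpow_atBot_of_base_gt_one 2 one_lt_two).comp
          (tendsto_intCast_atBot_iff (R := ℝ).2 tendsto_id))
      simpa using h2.div_const 2
    · exact Set.mem_Ioi.2 (by positivity)
  have h1 := hx (fun k : ℤ => dyadicCenter k (dyadicIndex k x)) _ hδ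
    (Eventually.of_forall fun k => by
      rw [one_mul]
      exact dyadicCube_subset_closedBall _ _ (mem_dyadicCube_dyadicIndex k x))
  rw [tendsto_iff_norm_sub_tendsto_zero]
  refine squeeze_zero (fun _ => norm_nonneg _) (fun k => ?_)
    ((h1.const_mul (D ^ (n + 1)).toReal).trans_eq (by rw [mul_zero]))
  have hc := isCompact_closedBall (dyadicCenter k (dyadicIndex k x)) ((2 : ℝ) ^ k / 2)
  refine abs_setAverage_sub_le (dyadicCube_subset_closedBall _ _) ?_ hc.measure_lt_top.ne
    (ENNReal.pow_ne_top hD) (h.measure_closedBall_le_dyadicCube _ _)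
    (hf.integrableOn_isCompact hc) _
  exact ((h.measure_closedBall_pos _ (by positivity)).trans_le
    (measure_mono (closedBall_subset_dyadicCube _ _))).ne'

/-- For large `l` there is a small dyadic scale with `2 ^ (k * γ / p) * A ≥ l` at which
`l ^ p * 2 ^ (-k * γ)` is still comparable to `A ^ p`. -/
lemma eventually_exists_scale {p γ A : ℝ} (hp : 0 < p) (hγ : γ < 0) (hA : 0 < A) (k₁ : ℤ) :
    ∀ᶠ l : ℝ in atTop, ∃ k ≤ k₁, l ≤ ((2 : ℝ) ^ k) ^ (γ / p) * A ∧
      A ^ p * 2 ^ γ ≤ l ^ p * ((2 : ℝ) ^ k) ^ (-γ) := by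
  have hpos : 0 < p / (-γ) := div_pos hp (neg_pos.2 hγ)
  have hlim : Tendsto (fun l : ℝ => (A / l) ^ (p / (-γ))) atTop (𝓝 0) := by
    have h0 : Tendsto (fun l : ℝ => A / l) atTop (𝓝 0) := tendsto_const_nhds.div_atTop tendsto_id
    have := h0.rpow_const (p := p / (-γ)) (Or.inr hpos.le)
    rwa [Real.zero_rpow hpos.ne'] at this
  filter_upwards [eventually_gt_atTop 0,
    hlim.eventually_lt_const (show (0 : ℝ) < 2 ^ k₁ by positivity)] with l hl hlk
  have hAl : 0 < A / l := div_pos hA hl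
  obtain ⟨k, hk1, hk2⟩ := exists_mem_Ico_zpow
    (Real.rpow_pos_of_pos hAl (p / (-γ))) (one_lt_two (α := ℝ))
  have h2k : (0 : ℝ) < 2 ^ k := by positivity
  have hγ0 : γ ≠ 0 := hγ.ne
  refine ⟨k, ((zpow_lt_zpow_iff_right₀ (one_lt_two (α := ℝ))).1 (hk1.trans_lt hlk)).le, ?_, ?_⟩
  · have h1 := Real.rpow_le_rpow_of_nonpos h2k hk1 (div_neg_of_neg_of_pos hγ hp).le
    rw [← Real.rpow_mul hAl.le, show p / (-γ) * (γ / p) = -1 by field_simp, Real.rpow_neg_one,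
      inv_div] at h1
    calc l = l / A * A := by field_simp
      _ ≤ _ := by gcongr
  · rw [zpow_add_one₀ two_ne_zero] at hk2
    have h1 := Real.rpow_le_rpow (by positivity) hk2.le (neg_nonneg.2 hγ.le)
    rw [← Real.rpow_mul hAl.le, show p / (-γ) * (-γ) = p by field_simp,
      Real.mul_rpow h2k.le two_pos.le, Real.div_rpow hA.le hl.le,
      Real.rpow_neg two_pos.le] at h1
    have hlp : 0 < l ^ p := Real.rpow_pos_of_pos hl p
    have h2 : (0 : ℝ) < 2 ^ γ := by positivity
    rw [div_le_iff₀ hlp] at h1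
    calc A ^ p * 2 ^ γ ≤ (((2 : ℝ) ^ k) ^ (-γ) * (2 ^ γ)⁻¹ * l ^ p) * 2 ^ γ := by gcongr
      _ = _ := by field_simp

/-- The dyadic sum of the theorem localised at the point `x`. -/
def dyadicSumAt {n : ℕ} (w : ℤ → ℝ≥0∞) (S : Set (ℤ × (Fin n → ℤ))) (x : Fin n → ℝ) : ℝ≥0∞ :=
  ∑' Q : ℤ × (Fin n → ℤ), (dyadicCube n Q.1 Q.2).indicator (fun _ => if Q ∈ S then w Q.1 else 0) x

lemma measurable_dyadicSumAt {n : ℕ} (w : ℤ → ℝ≥0∞) (S : Set (ℤ × (Fin n → ℤ))) :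
    Measurable (dyadicSumAt w S) :=
  Measurable.tsum fun Q =>
    measurable_const.indicator (measurableSet_dyadicCube n Q.1 Q.2)

lemma lintegral_dyadicSumAt {n : ℕ} (μ : Measure (Fin n → ℝ)) (w : ℤ → ℝ≥0∞)
    (S : Set (ℤ × (Fin n → ℤ))) :
    ∫⁻ x, dyadicSumAt w S x ∂μ =
      ∑' Q : ℤ × (Fin n → ℤ), if Q ∈ S then w Q.1 * μ (dyadicCube n Q.1 Q.2) else 0 := by
  unfold dyadicSumAt
  rw [lintegral_tsum fun Q =>
    (Measurable.indicator (f := fun _ => if Q ∈ S then w Q.1 else 0) measurable_const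
      (measurableSet_dyadicCube n Q.1 Q.2)).aemeasurable]
  refine tsum_congr fun Q => ?_
  rw [lintegral_indicator_const (measurableSet_dyadicCube n Q.1 Q.2)]
  split_ifs <;> simp

lemma le_dyadicSumAt {n : ℕ} (w : ℤ → ℝ≥0∞) {S : Set (ℤ × (Fin n → ℤ))} {x : Fin n → ℝ} {k : ℤ}
    (hk : (k, dyadicIndex k x) ∈ S) : w k ≤ dyadicSumAt w S x := by
  refine le_trans ?_ (ENNReal.le_tsum (k, dyadicIndex k x))
  rw [Set.indicator_of_mem (mem_dyadicCube_dyadicIndex k x), if_pos hk]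

/-- for a doubling Radon measure `μ` (with doubling constant `C_D`),
`1 ≤ p < ∞`, `γ < 0` and `f ∈ L¹_loc(μ)`, with `a(f)_Q = ℓ(Q)^{γ/p} ⨍_Q f dμ`
(which is `0` when `μ(Q) = 0`), one has
`∫ |f|^p dμ ≤ C limsup_{λ→∞} λ^p ∑_{|a(f)_Q|>λ} ℓ(Q)^{-γ} μ(Q)`. -/
theorem statement14 (n : ℕ) (p γ C_D : ℝ) (hp : 1 ≤ p) (hγ : γ < 0) :
    ∃ C : ℝ, 0 < C ∧
      ∀ (μ : Measure (Fin n → ℝ)), IsFiniteMeasureOnCompacts μ →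
      (∀ (x : Fin n → ℝ) (r : ℝ), 0 < r →
        0 < μ (eBall x (2 * r)) ∧ μ (eBall x (2 * r)) ≤ ENNReal.ofReal C_D * μ (eBall x r)) →
      ∀ f : (Fin n → ℝ) → ℝ, LocallyIntegrable f μ →
      (∫⁻ x, ENNReal.ofReal (|f x| ^ p) ∂μ)
        ≤ ENNReal.ofReal C *
          Filter.limsup
            (fun l : ℝ => ENNReal.ofReal (l ^ p) *
              ∑' Q : ℤ × (Fin n → ℤ),
                if l < |((2 : ℝ) ^ Q.1) ^ (γ / p) * ⨍ x in dyadicCube n Q.1 Q.2, f x ∂μ| then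
                  ENNReal.ofReal (((2 : ℝ) ^ Q.1) ^ (-γ)) * μ (dyadicCube n Q.1 Q.2) else 0)
            Filter.atTop := by
  refine ⟨2 ^ (p - γ), by positivity, ?_⟩
  intro μ _ hμ f hf
  have hp0 : 0 < p := by linarith
  set w : ℤ → ℝ≥0∞ := fun k => ENNReal.ofReal (((2 : ℝ) ^ k) ^ (-γ)) with hw
  set S : ℝ → Set (ℤ × (Fin n → ℤ)) := fun l =>
    {Q | l < |((2 : ℝ) ^ Q.1) ^ (γ / p) * ⨍ x in dyadicCube n Q.1 Q.2, f x ∂μ|} with hS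
  have hdiff := EDoubling.ae_tendsto_dyadic_average (D := ENNReal.ofReal C_D) hμ
    ENNReal.ofReal_ne_top hf
  have hpt : ∀ᵐ x ∂μ, ENNReal.ofReal (|f x| ^ p) ≤ ENNReal.ofReal (2 ^ (p - γ)) *
      liminf (fun m : ℕ => ENNReal.ofReal ((m : ℝ) ^ p) * dyadicSumAt w (S m) x) atTop := by
    filter_upwards [hdiff] with x hx
    rcases eq_or_ne (f x) 0 with h0 | h0
    · simp [h0, Real.zero_rpow hp0.ne']
    have hA : 0 < |f x| / 2 := by positivity
    obtain ⟨k₁, hk₁⟩ := eventually_atBot.1 (hx.abs.eventually_const_lt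
      (show |f x| / 2 < |f x| by linarith))
    have hev : ENNReal.ofReal ((|f x| / 2) ^ p * 2 ^ γ) ≤
        liminf (fun m : ℕ => ENNReal.ofReal ((m : ℝ) ^ p) * dyadicSumAt w (S m) x) atTop := by
      refine le_liminf_of_le (by isBoundedDefault) ?_
      filter_upwards [tendsto_natCast_atTop_atTop.eventually
        (eventually_exists_scale hp0 hγ hA k₁)] with m hm
      obtain ⟨k, hk, hk1, hk2⟩ := hm
      have hmem : (k, dyadicIndex k x) ∈ S m := by
        have h2 : (0 : ℝ) < ((2 : ℝ) ^ k) ^ (γ / p) := by positivity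
        simp only [hS, Set.mem_ofPred_eq]
        rw [abs_mul, abs_of_pos h2]
        exact hk1.trans_lt (mul_lt_mul_of_pos_left (hk₁ k hk) h2)
      calc _ ≤ ENNReal.ofReal ((m : ℝ) ^ p * ((2 : ℝ) ^ k) ^ (-γ)) := ENNReal.ofReal_le_ofReal hk2
        _ = ENNReal.ofReal ((m : ℝ) ^ p) * w k := ENNReal.ofReal_mul (by positivity)
        _ ≤ _ := by gcongr; exact le_dyadicSumAt w hmem
    refine le_trans (le_of_eq ?_) (mul_le_mul_right hev _)
    rw [← ENNReal.ofReal_mul (by positivity), Real.div_rpow (abs_nonneg _) two_pos.le,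
      Real.rpow_sub two_pos]
    congr 1
    have h2p : (0 : ℝ) < 2 ^ p := by positivity
    have h2γ : (0 : ℝ) < 2 ^ γ := by positivity
    field_simp
  refine (lintegral_mono_ae hpt).trans ?_
  rw [lintegral_const_mul' _ _ ENNReal.ofReal_ne_top]
  gcongr
  refine (lintegral_liminf_le fun m => (measurable_dyadicSumAt _ _).const_mul _).trans ?_
  refine (liminf_le_limsup (by isBoundedDefault) (by isBoundedDefault)).trans ?_
  simp_rw [lintegral_const_mul _ (measurable_dyadicSumAt _ _), lintegral_dyadicSumAt]
  exact limsup_le_limsup_of_le (tendsto_natCast_atTop_atTop (R := ℝ)) (u := fun l : ℝ =>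
    ENNReal.ofReal (l ^ p) * ∑' Q : ℤ × (Fin n → ℤ),
      if Q ∈ S l then w Q.1 * μ (dyadicCube n Q.1 Q.2) else 0)
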